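/- There exists c > 0, depending only on n, λ, Λ, such that for every short-geodesic trajectory with data (y₀, η₀, s) with 0 < s ≤ c one has 1/2 ≤ ⟨A(x(t),y(t))η(t), η(t)⟩ ≤ 3/2 for all t ∈ [0,T]. -/

import Mathlib

open Set

noncomputable section

/-- `quadForm M v w = ⟨M v, w⟩`, the bilinear form of the matrix `M` with respect to the
standard inner product on `ℝ^m`. -/
def quadForm {m : ℕ} (M : Matrix (Fin m) (Fin m) ℝ) (v w : Fin m → ℝ) : ℝ :=
  ∑ i, (∑ j, M i j * v j) * w i

/-- The Euclidean norm of a vector in `ℝ^m`. -/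
def euclNorm {m : ℕ} (v : Fin m → ℝ) : ℝ :=
  Real.sqrt (∑ i, v i ^ 2)

/-- Entrywise partial derivative `∂ₓ A` of a matrix-valued map in its first (scalar) variable. -/
def dxA {m : ℕ} (A : ℝ → (Fin m → ℝ) → Matrix (Fin m) (Fin m) ℝ)
    (x : ℝ) (y : Fin m → ℝ) : Matrix (Fin m) (Fin m) ℝ :=
  Matrix.of fun i j => deriv (fun x' => A x' y i j) x

/-- Entrywise partial derivative `∂_{y k} A` of a matrix-valued map in the `k`-th component of
its second (vector) variable. -/
def dyA {m : ℕ} (A : ℝ → (Fin m → ℝ) → Matrix (Fin m) (Fin m) ℝ)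
    (k : Fin m) (x : ℝ) (y : Fin m → ℝ) : Matrix (Fin m) (Fin m) ℝ :=
  Matrix.of fun i j => deriv (fun s => A x (Function.update y k s) i j) (y k)

/-- Partial derivative `∂ₓ f` of a scalar function of `(x, y)`. -/
def dxF {m : ℕ} (f : ℝ → (Fin m → ℝ) → ℝ) (x : ℝ) (y : Fin m → ℝ) : ℝ :=
  deriv (fun x' => f x' y) x

/-- Partial derivative `∂_{y k} f` of a scalar function of `(x, y)`. -/
def dyF {m : ℕ} (f : ℝ → (Fin m → ℝ) → ℝ) (k : Fin m) (x : ℝ) (y : Fin m → ℝ) : ℝ :=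
  deriv (fun s => f x (Function.update y k s)) (y k)

/-- Iterated partial derivative `∂ₓ^k f` of a scalar function of `(x, y)`. -/
def dxIter {m : ℕ} : ℕ → (ℝ → (Fin m → ℝ) → ℝ) → ℝ → (Fin m → ℝ) → ℝ
  | 0, f => f
  | (k+1), f => dxF (dxIter k f)

/-- The standing hypotheses on the data of a gas giant in `g`-boundary normal coordinates:
`n ≥ 2`, `ε ∈ (0,1]`, `U ⊆ ℝ^{n-1}` open, and `A : [0,ε) × U → ℝ^{(n-1)×(n-1)}` symmetric
positive definite (with uniform ellipticity constants `0 < lam ≤ Lam`), extending to a `C^∞`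
map on an open neighborhood of `[0,ε) × U`, with all first-order partial derivatives of all
entries bounded by `Lam`.  (`A` plays the role of the inverse boundary metric `h^{ij}` of the
gas giant metric `g = dx² + x⁻² h(x,y,dy)`.) -/
structure GasGiantData (n : ℕ) (ε : ℝ) (U : Set (Fin (n-1) → ℝ))
    (A : ℝ → (Fin (n-1) → ℝ) → Matrix (Fin (n-1)) (Fin (n-1)) ℝ)
    (lam Lam : ℝ) : Prop where
  hn : 2 ≤ n
  hε : ε ∈ Set.Ioc (0:ℝ) 1
  hU : IsOpen U
  hlam : 0 < lam
  hlamLam : lam ≤ Lam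
  hsymm : ∀ x ∈ Set.Ico (0:ℝ) ε, ∀ y ∈ U, (A x y).IsSymm
  hsmooth : ∃ W : Set (ℝ × (Fin (n-1) → ℝ)), IsOpen W ∧ Set.Ico (0:ℝ) ε ×ˢ U ⊆ W ∧
    ∀ i j, ContDiffOn ℝ (⊤ : ℕ∞) (fun p : ℝ × (Fin (n-1) → ℝ) => A p.1 p.2 i j) W
  hposdef : ∀ x ∈ Set.Ico (0:ℝ) ε, ∀ y ∈ U, ∀ v : Fin (n-1) → ℝ,
    lam * (∑ i, v i ^ 2) ≤ quadForm (A x y) v v ∧ quadForm (A x y) v v ≤ Lam * (∑ i, v i ^ 2)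
  hderivBound : ∀ x ∈ Set.Ico (0:ℝ) ε, ∀ y ∈ U,
    (∀ i j, |dxA A x y i j| ≤ Lam) ∧ (∀ k i j, |dyA A k x y i j| ≤ Lam)

/-- A Hamiltonian trajectory on the interval `I` for the gas giant Hamiltonian
`H(x,y,ξ,η) = ½ ξ² + ½ x² ⟨A(x,y)η, η⟩`: a `C¹` curve
`t ↦ (x(t), y(t), ξ(t), η(t)) ∈ [0,ε) × U × ℝ × ℝ^{n-1}` satisfying Hamilton's equations. -/
structure IsHamTraj (n : ℕ) (ε : ℝ) (U : Set (Fin (n-1) → ℝ))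
    (A : ℝ → (Fin (n-1) → ℝ) → Matrix (Fin (n-1)) (Fin (n-1)) ℝ) (I : Set ℝ)
    (x : ℝ → ℝ) (y : ℝ → Fin (n-1) → ℝ) (ξ : ℝ → ℝ) (η : ℝ → Fin (n-1) → ℝ) : Prop where
  mem : ∀ t ∈ I, x t ∈ Set.Ico (0:ℝ) ε ∧ y t ∈ U
  hx : ∀ t ∈ I, HasDerivAt x (ξ t) t
  hy : ∀ t ∈ I, ∀ i, HasDerivAt (fun t' => y t' i)
    ((x t)^2 * ∑ j, A (x t) (y t) i j * η t j) t
  hxi : ∀ t ∈ I, HasDerivAt ξ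
    (-(x t * quadForm (A (x t) (y t)) (η t) (η t))
      - (1/2) * (x t)^2 * quadForm (dxA A (x t) (y t)) (η t) (η t)) t
  heta : ∀ t ∈ I, ∀ i, HasDerivAt (fun t' => η t' i)
    (-(1/2) * (x t)^2 * quadForm (dyA A i (x t) (y t)) (η t) (η t)) t

/-- A short-geodesic trajectory with data `(y₀, η₀, s)`: a Hamiltonian trajectory on `[0,T]`,
`T > 0`, with initial value `(0, y₀, s, η₀)`, with `x(T) = 0` and `x(t) > 0` on `(0,T)`. -/
def IsShortGeo (n : ℕ) (ε : ℝ) (U : Set (Fin (n-1) → ℝ))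
    (A : ℝ → (Fin (n-1) → ℝ) → Matrix (Fin (n-1)) (Fin (n-1)) ℝ)
    (y₀ η₀ : Fin (n-1) → ℝ) (s T : ℝ)
    (x : ℝ → ℝ) (y : ℝ → Fin (n-1) → ℝ) (ξ : ℝ → ℝ) (η : ℝ → Fin (n-1) → ℝ) : Prop :=
  0 < T ∧ IsHamTraj n ε U A (Set.Icc 0 T) x y ξ η ∧
    x 0 = 0 ∧ y 0 = y₀ ∧ ξ 0 = s ∧ η 0 = η₀ ∧ x T = 0 ∧ ∀ t ∈ Set.Ioo 0 T, 0 < x t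

/-- A function of one variable whose derivative is nonnegative on an interval is monotone there,
in pointwise form. -/
lemma le_of_hasDerivAt_nonneg {f f' : ℝ → ℝ} {a b : ℝ} (hab : a ≤ b)
    (hf : ∀ t ∈ Icc a b, HasDerivAt f (f' t) t) (hf' : ∀ t ∈ Icc a b, 0 ≤ f' t) :
    f a ≤ f b := by
  have hmono : MonotoneOn f (Icc a b) :=
    monotoneOn_of_hasDerivWithinAt_nonneg (convex_Icc a b)
      (fun t ht => (hf t ht).continuousAt.continuousWithinAt)
      (fun t ht => (hf t (interior_subset ht)).hasDerivWithinAt)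
      (fun t ht => hf' t (interior_subset ht))
  exact hmono (left_mem_Icc.2 hab) (right_mem_Icc.2 hab) hab

/-- If `x' = ξ ≥ 0` and `q' = ξ P` with `|P| ≤ C q`, then `q` grows or decays at most like
`exp (± C x)`. -/
lemma exp_bounds_of_nonneg {x ξ q P : ℝ → ℝ} {a b C : ℝ} (hab : a ≤ b)
    (hx : ∀ t ∈ Icc a b, HasDerivAt x (ξ t) t)
    (hq : ∀ t ∈ Icc a b, HasDerivAt q (ξ t * P t) t)
    (hP : ∀ t ∈ Icc a b, |P t| ≤ C * q t) (hξ : ∀ t ∈ Icc a b, 0 ≤ ξ t) :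
    q a * Real.exp (-(C * (x b - x a))) ≤ q b ∧ q b ≤ q a * Real.exp (C * (x b - x a)) := by
  have key (K : ℝ) (t : ℝ) (ht : t ∈ Icc a b) :
      HasDerivAt (fun r => q r * Real.exp (K * (x r - x b)))
        (ξ t * (P t + K * q t) * Real.exp (K * (x t - x b))) t := by
    have h := (hq t ht).mul (((hx t ht).sub_const (x b)).const_mul K).exp
    refine h.congr_deriv ?_
    ring
  constructor
  · have h := le_of_hasDerivAt_nonneg hab (key C) fun t ht =>
      mul_nonneg (mul_nonneg (hξ t ht) (by linarith [(abs_le.1 (hP t ht)).1])) (Real.exp_pos _).le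
    simp only [sub_self, mul_zero, Real.exp_zero, mul_one] at h
    convert h using 3
    ring
  · have h := le_of_hasDerivAt_nonneg hab (fun t ht => (key (-C) t ht).neg) fun t ht => by
      have h1 := (abs_le.1 (hP t ht)).2
      have h2 := mul_nonneg (mul_nonneg (hξ t ht) (by linarith : 0 ≤ C * q t - P t))
        (Real.exp_pos (-C * (x t - x b))).le
      linarith
    simp only [Pi.neg_apply, sub_self, mul_zero, Real.exp_zero, mul_one, neg_le_neg_iff] at h
    convert h using 3
    ring

/-- Comparison of `q` with its initial value along the reduced flow, as long as `C x ≤ 1 / 10`. -/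
lemma reduced_flow_bounds {x ξ q P : ℝ → ℝ} {T C : ℝ} (hC : 0 < C)
    (hx : ∀ t ∈ Icc 0 T, HasDerivAt x (ξ t) t)
    (hξ : ∀ t ∈ Icc 0 T, HasDerivAt ξ (-(x t * q t) - (1/2) * (x t)^2 * P t) t)
    (hq : ∀ t ∈ Icc 0 T, HasDerivAt q (ξ t * P t) t)
    (hP : ∀ t ∈ Icc 0 T, |P t| ≤ C * q t)
    (hx0 : x 0 = 0) (hq0 : q 0 = 1) (hξ0 : 0 < ξ 0) (hxn : ∀ t ∈ Icc 0 T, 0 ≤ x t)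
    (hxC : ∀ t ∈ Icc 0 T, C * x t ≤ 1 / 10) :
    ∀ t ∈ Icc 0 T, 1 / 2 ≤ q t ∧ q t ≤ 3 / 2 := by
  have hqn (t : ℝ) (ht : t ∈ Icc 0 T) : 0 ≤ q t :=
    nonneg_of_mul_nonneg_right ((abs_nonneg _).trans (hP t ht)) hC
  have hanti : AntitoneOn ξ (Icc 0 T) := by
    refine antitoneOn_of_hasDerivWithinAt_nonpos (convex_Icc 0 T)
      (fun t ht => (hξ t ht).continuousAt.continuousWithinAt)
      (fun t ht => (hξ t (interior_subset ht)).hasDerivWithinAt) (fun t ht => ?_)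
    replace ht := interior_subset ht
    have h1 := (abs_le.1 (hP t ht)).1
    have h2 := mul_nonneg (sq_nonneg (x t)) (by linarith : 0 ≤ P t + C * q t)
    have h3 := mul_nonneg (mul_nonneg (hxn t ht) (hqn t ht))
      (by linarith [hxC t ht] : 0 ≤ 1 - C * x t)
    have h4 := mul_nonneg (hxn t ht) (hqn t ht)
    nlinarith
  have hlow : ∀ r : ℝ, r ≤ 1 / 10 → 9 / 10 ≤ Real.exp (-r) := fun r hr => by
    linarith [Real.add_one_le_exp (-r)]
  have hup : ∀ r : ℝ, r ≤ 1 / 10 → Real.exp r ≤ 10 / 9 := fun r hr => by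
    have h1 := hlow r hr
    have h2 : Real.exp (-r) * Real.exp r = 1 := by rw [← Real.exp_add]; simp
    nlinarith [Real.exp_pos r]
  have rise (t : ℝ) (ht : t ∈ Icc 0 T) (hpos : 0 ≤ ξ t) : 9 / 10 ≤ q t ∧ q t ≤ 10 / 9 := by
    have hsub (r : ℝ) (hr : r ∈ Icc 0 t) : r ∈ Icc 0 T := ⟨hr.1, hr.2.trans ht.2⟩
    have h := exp_bounds_of_nonneg ht.1 (fun r hr => hx r (hsub r hr))
      (fun r hr => hq r (hsub r hr)) (fun r hr => hP r (hsub r hr))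
      (fun r hr => hpos.trans (hanti (hsub r hr) ht hr.2))
    rw [hq0, hx0, sub_zero, one_mul, one_mul] at h
    exact ⟨(hlow _ (hxC t ht)).trans h.1, h.2.trans (hup _ (hxC t ht))⟩
  intro t ht
  rcases le_total 0 (ξ t) with hpos | hneg
  · have h := rise t ht hpos
    constructor <;> linarith [h.1, h.2]
  · obtain ⟨a, ha, hξa⟩ : (0 : ℝ) ∈ ξ '' Icc 0 t :=
      intermediate_value_Icc' ht.1
        (fun r hr => (hξ r ⟨hr.1, hr.2.trans ht.2⟩).continuousAt.continuousWithinAt)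
        ⟨hneg, hξ0.le⟩
    have haT : a ∈ Icc 0 T := ⟨ha.1, ha.2.trans ht.2⟩
    have hsub (r : ℝ) (hr : r ∈ Icc a t) : r ∈ Icc 0 T := ⟨ha.1.trans hr.1, hr.2.trans ht.2⟩
    have hqa := rise a haT hξa.ge
    have h := exp_bounds_of_nonneg (x := fun r => -x r) (ξ := fun r => -ξ r)
      (P := fun r => -P r) ha.2 (fun r hr => (hx r (hsub r hr)).neg)
      (fun r hr => (hq r (hsub r hr)).congr_deriv (by ring))
      (fun r hr => by simpa only [abs_neg] using hP r (hsub r hr))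
      (fun r hr => by linarith [hanti haT (hsub r hr) hr.1])
    have hr : C * (-x t - -x a) ≤ 1 / 10 := by
      nlinarith [hxC a haT, mul_nonneg hC.le (hxn t ht)]
    have h1 := hlow _ hr
    have h2 := hup _ hr
    constructor
    · nlinarith [h.1, hqa.1]
    · nlinarith [h.2, hqa.2, hqa.1]

/-- Energy conservation for the reduced flow. -/
lemma reduced_flow_energy {x ξ q P : ℝ → ℝ} {T : ℝ}
    (hx : ∀ t ∈ Icc 0 T, HasDerivAt x (ξ t) t)
    (hξ : ∀ t ∈ Icc 0 T, HasDerivAt ξ (-(x t * q t) - (1/2) * (x t)^2 * P t) t)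
    (hq : ∀ t ∈ Icc 0 T, HasDerivAt q (ξ t * P t) t) (hx0 : x 0 = 0) :
    ∀ t ∈ Icc 0 T, ξ t ^ 2 + x t ^ 2 * q t = ξ 0 ^ 2 := by
  have hE (t : ℝ) (ht : t ∈ Icc 0 T) :
      HasDerivAt (fun r => ξ r ^ 2 + x r ^ 2 * q r) 0 t := by
    refine (((hξ t ht).pow 2).add (((hx t ht).pow 2).mul (hq t ht))).congr_deriv ?_
    simp only [Pi.pow_apply]
    ring
  intro t ht
  have h := constant_of_has_deriv_right_zero
    (fun r hr => (hE r hr).continuousAt.continuousWithinAt)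
    (fun r hr => (hE r (Ico_subset_Icc_self hr)).hasDerivWithinAt) t ht
  simpa [hx0] using h

/-- Small initial speed keeps `q` within `[1/2, 3/2]` along the reduced flow. -/
lemma reduced_flow_bounds_of_small {x ξ q P : ℝ → ℝ} {T C : ℝ} (hC : 0 < C)
    (hx : ∀ t ∈ Icc 0 T, HasDerivAt x (ξ t) t)
    (hξ : ∀ t ∈ Icc 0 T, HasDerivAt ξ (-(x t * q t) - (1/2) * (x t)^2 * P t) t)
    (hq : ∀ t ∈ Icc 0 T, HasDerivAt q (ξ t * P t) t)
    (hP : ∀ t ∈ Icc 0 T, |P t| ≤ C * q t)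
    (hx0 : x 0 = 0) (hq0 : q 0 = 1) (hξ0 : 0 < ξ 0) (hxn : ∀ t ∈ Icc 0 T, 0 ≤ x t)
    (hs : ξ 0 ≤ 1 / (20 * C)) :
    ∀ t ∈ Icc 0 T, 1 / 2 ≤ q t ∧ q t ≤ 3 / 2 := by
  refine reduced_flow_bounds hC hx hξ hq hP hx0 hq0 hξ0 hxn fun t ht => ?_
  by_contra! hlt
  have hcont (b : ℝ) (hb : b ≤ T) : ContinuousOn (fun r => C * x r) (Icc 0 b) := fun r hr =>
    ((hx r ⟨hr.1, hr.2.trans hb⟩).continuousAt.const_mul C).continuousWithinAt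
  obtain ⟨τ, ⟨hτ, hτx⟩, hmin⟩ :
      ∃ τ, IsLeast (Icc 0 T ∩ (fun r => C * x r) ⁻¹' Ici (1 / 10)) τ :=
    (isCompact_Icc.of_isClosed_subset
      ((hcont T le_rfl).preimage_isClosed_of_isClosed isClosed_Icc isClosed_Ici)
      inter_subset_left).exists_isLeast ⟨t, ht, hlt.le⟩
  obtain ⟨r, hr, hrx⟩ : (1 / 10 : ℝ) ∈ (fun r => C * x r) '' Icc 0 τ :=
    intermediate_value_Icc hτ.1 (hcont τ hτ.2) ⟨by simp [hx0], hτx⟩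
  have hrτ : r = τ := le_antisymm hr.2 (hmin ⟨⟨hr.1, hr.2.trans hτ.2⟩, hrx.ge⟩)
  subst hrτ
  have hsub (a : ℝ) (ha : a ∈ Icc 0 r) : a ∈ Icc 0 T := ⟨ha.1, ha.2.trans hτ.2⟩
  have hb := reduced_flow_bounds hC (fun a ha => hx a (hsub a ha)) (fun a ha => hξ a (hsub a ha))
    (fun a ha => hq a (hsub a ha)) (fun a ha => hP a (hsub a ha)) hx0 hq0 hξ0
    (fun a ha => hxn a (hsub a ha)) (fun a ha => by
      by_contra! hgt
      have hra : r = a := le_antisymm (hmin ⟨hsub a ha, hgt.le⟩) ha.2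
      subst hra
      exact hgt.ne' hrx) r hr
  have hE := reduced_flow_energy hx hξ hq hx0 r hτ
  have hCs : C * ξ 0 ≤ 1 / 20 := by
    rw [le_div_iff₀ (by positivity)] at hs
    linarith
  have hCs2 : (C * ξ 0) ^ 2 ≤ (1 / 20) ^ 2 := pow_le_pow_left₀ (by positivity) hCs 2
  have hCx : (C * x r) ^ 2 = (1 / 10) ^ 2 := by rw [show C * x r = 1 / 10 from hrx]
  have hCE : (C * ξ r) ^ 2 + (C * x r) ^ 2 * q r = (C * ξ 0) ^ 2 := by
    linear_combination C ^ 2 * hE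
  rw [hCx] at hCE
  nlinarith [sq_nonneg (C * ξ r), hb.1]

/-- A quadratic form with entries bounded by `L` is bounded by `m L ‖v‖²`. -/
lemma abs_quadForm_le {m : ℕ} {M : Matrix (Fin m) (Fin m) ℝ} {L : ℝ} (hL : 0 ≤ L)
    (hM : ∀ i j, |M i j| ≤ L) (v : Fin m → ℝ) :
    |quadForm M v v| ≤ m * L * ∑ i, v i ^ 2 := by
  calc |quadForm M v v| ≤ ∑ i, |(∑ j, M i j * v j) * v i| := Finset.abs_sum_le_sum_abs _ _
    _ ≤ ∑ i, (∑ j, L * |v j|) * |v i| := by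
        refine Finset.sum_le_sum fun i _ => ?_
        rw [abs_mul]
        refine mul_le_mul_of_nonneg_right ?_ (abs_nonneg _)
        refine (Finset.abs_sum_le_sum_abs _ _).trans (Finset.sum_le_sum fun j _ => ?_)
        rw [abs_mul]
        exact mul_le_mul_of_nonneg_right (hM i j) (abs_nonneg _)
    _ = L * (∑ i, |v i|) ^ 2 := by
        rw [← Finset.mul_sum, ← Finset.mul_sum]
        ring
    _ ≤ L * (m * ∑ i, v i ^ 2) := by
        refine mul_le_mul_of_nonneg_left ?_ hL
        simpa using sq_sum_le_card_mul_sum_sq (s := Finset.univ) (f := fun i => |v i|)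
    _ = m * L * ∑ i, v i ^ 2 := by ring

/-- Chain rule for a scalar function of `(x, y)` along a curve, in terms of partial derivatives. -/
lemma hasDerivAt_comp_curve {m : ℕ} {f : ℝ → (Fin m → ℝ) → ℝ} {x : ℝ → ℝ} {y : ℝ → Fin m → ℝ}
    {t x' : ℝ} {y' : Fin m → ℝ}
    (hf : DifferentiableAt ℝ (fun p : ℝ × (Fin m → ℝ) => f p.1 p.2) (x t, y t))
    (hx : HasDerivAt x x' t) (hy : ∀ i, HasDerivAt (fun r => y r i) (y' i) t) :
    HasDerivAt (fun r => f (x r) (y r))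
      (x' * dxF f (x t) (y t) + ∑ k, y' k * dyF f k (x t) (y t)) t := by
  set F := fun p : ℝ × (Fin m → ℝ) => f p.1 p.2
  set D := fderiv ℝ F (x t, y t)
  have hD : HasFDerivAt F D (x t, y t) := hf.hasFDerivAt
  have hdx : dxF f (x t) (y t) = D (1, 0) := by
    have h : HasDerivAt (fun a => f a (y t)) (D (1, 0)) (x t) :=
      HasFDerivAt.comp_hasDerivAt (l := F) (f := fun a => (a, y t)) (x t) hD
        ((hasDerivAt_id (x t)).prodMk (hasDerivAt_const (x t) (y t)))
    exact h.deriv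
  have hdy (k : Fin m) : dyF f k (x t) (y t) = D (0, Pi.single k 1) := by
    have hD' : HasFDerivAt F D (x t, Function.update (y t) k (y t k)) := by
      rwa [Function.update_eq_self]
    exact (hD'.comp_hasDerivAt (y t k)
      ((hasDerivAt_const (y t k) (x t)).prodMk (hasDerivAt_update (y t) k (y t k)))).deriv
  have h := hD.comp_hasDerivAt t (hx.prodMk (hasDerivAt_pi.2 hy))
  refine h.congr_deriv ?_
  have hvec : ((x', y') : ℝ × (Fin m → ℝ)) =
      x' • (1, 0) + ∑ k, y' k • ((0, Pi.single k 1) : ℝ × (Fin m → ℝ)) := by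
    ext i
    · simp [Prod.fst_sum]
    · simp [Prod.snd_sum, Finset.sum_apply, Pi.single_apply]
  rw [hvec, map_add, map_sum, hdx]
  simp only [map_smul, smul_eq_mul, hdy]

/-- Along a Hamiltonian trajectory, `⟨A η, η⟩' = ξ ⟨∂ₓA η, η⟩`. -/
lemma hasDerivAt_quadForm_traj {n : ℕ} {ε lam Lam : ℝ} {U : Set (Fin (n-1) → ℝ)}
    {A : ℝ → (Fin (n-1) → ℝ) → Matrix (Fin (n-1)) (Fin (n-1)) ℝ} {I : Set ℝ}
    {x : ℝ → ℝ} {y : ℝ → Fin (n-1) → ℝ} {ξ : ℝ → ℝ} {η : ℝ → Fin (n-1) → ℝ}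
    (hA : GasGiantData n ε U A lam Lam) (h : IsHamTraj n ε U A I x y ξ η) {t : ℝ} (ht : t ∈ I) :
    HasDerivAt (fun r => quadForm (A (x r) (y r)) (η r) (η r))
      (ξ t * quadForm (dxA A (x t) (y t)) (η t) (η t)) t := by
  obtain ⟨W, hW, hsub, hsm⟩ := hA.hsmooth
  have hmem := h.mem t ht
  have hAij (i j : Fin (n-1)) := hasDerivAt_comp_curve (f := fun a b => A a b i j)
    (((hsm i j).contDiffAt (hW.mem_nhds (hsub (mk_mem_prod hmem.1 hmem.2)))).differentiableAt
      (by simp)) (h.hx t ht) (h.hy t ht)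
  have hq := HasDerivAt.fun_sum fun i (_ : i ∈ Finset.univ) =>
    (HasDerivAt.fun_sum fun j (_ : j ∈ Finset.univ) =>
      (hAij i j).mul (h.heta t ht j)).mul (h.heta t ht i)
  refine hq.congr_deriv ?_
  have hsymm (i j : Fin (n-1)) : A (x t) (y t) i j = A (x t) (y t) j i :=
    (hA.hsymm _ hmem.1 _ hmem.2).apply j i
  have hdx (i j : Fin (n-1)) :
      dxF (fun a b => A a b i j) (x t) (y t) = dxA A (x t) (y t) i j := rfl
  have hdy (k i j : Fin (n-1)) :
      dyF (fun a b => A a b i j) k (x t) (y t) = dyA A k (x t) (y t) i j := rfl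
  simp only [hdx, hdy]
  set B := A (x t) (y t)
  set v := η t
  set g : Fin (n-1) → ℝ := fun k => quadForm (dyA A k (x t) (y t)) v v
  set w : Fin (n-1) → ℝ := fun i => ∑ j, B i j * v j
  have hswap : ∑ i, (∑ j, B i j * (-(1/2) * x t ^ 2 * g j)) * v i
      = -(1/2) * x t ^ 2 * ∑ k, w k * g k := by
    simp only [w, Finset.sum_mul, Finset.mul_sum]
    rw [Finset.sum_comm]
    refine Finset.sum_congr rfl fun i _ => Finset.sum_congr rfl fun j _ => ?_
    rw [hsymm j i]
    ring
  have hdiag : ∑ i, w i * (-(1/2) * x t ^ 2 * g i) = -(1/2) * x t ^ 2 * ∑ k, w k * g k := by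
    rw [Finset.mul_sum]
    exact Finset.sum_congr rfl fun i _ => by ring
  have hmain : ∑ i, (∑ j, (∑ k, x t ^ 2 * w k * dyA A k (x t) (y t) i j) * v j) * v i
      = x t ^ 2 * ∑ k, w k * g k := by
    simp only [g, quadForm, Finset.sum_mul, Finset.mul_sum]
    symm
    rw [Finset.sum_comm]
    refine Finset.sum_congr rfl fun i _ => ?_
    rw [Finset.sum_comm]
    refine Finset.sum_congr rfl fun j _ => Finset.sum_congr rfl fun k _ => ?_
    ring
  have hxpart : ∑ i, (∑ j, (ξ t * dxA A (x t) (y t) i j) * v j) * v i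
      = ξ t * quadForm (dxA A (x t) (y t)) v v := by
    simp only [quadForm, Finset.sum_mul, Finset.mul_sum]
    exact Finset.sum_congr rfl fun i _ => Finset.sum_congr rfl fun j _ => by ring
  have hsplit (i : Fin (n-1)) : (∑ j, ((ξ t * dxA A (x t) (y t) i j
        + ∑ k, x t ^ 2 * w k * dyA A k (x t) (y t) i j) * v j
        + B i j * (-(1/2) * x t ^ 2 * g j))) * v i + w i * (-(1/2) * x t ^ 2 * g i)
      = (∑ j, (ξ t * dxA A (x t) (y t) i j) * v j) * v i
        + (∑ j, (∑ k, x t ^ 2 * w k * dyA A k (x t) (y t) i j) * v j) * v i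
        + (∑ j, B i j * (-(1/2) * x t ^ 2 * g j)) * v i + w i * (-(1/2) * x t ^ 2 * g i) := by
    simp only [add_mul, Finset.sum_add_distrib]
  refine (Finset.sum_congr rfl fun i _ => hsplit i).trans ?_
  simp only [Finset.sum_add_distrib]
  rw [hswap, hdiag, hmain, hxpart]
  ring

/-- along short geodesics with speed `s ≤ c`, the `h`-norm of `η` stays between
`1/2` and `3/2`; `c` depends only on `n`, `lam`, `Lam`. -/
theorem stmt_8 (n : ℕ) (hn : 2 ≤ n) (lam Lam : ℝ) (hlam : 0 < lam) (hll : lam ≤ Lam) :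
    ∃ c > (0:ℝ),
      ∀ (ε : ℝ) (U : Set (Fin (n-1) → ℝ))
        (A : ℝ → (Fin (n-1) → ℝ) → Matrix (Fin (n-1)) (Fin (n-1)) ℝ),
        GasGiantData n ε U A lam Lam →
        ∀ (y₀ η₀ : Fin (n-1) → ℝ) (s T : ℝ)
          (x : ℝ → ℝ) (y : ℝ → Fin (n-1) → ℝ) (ξ : ℝ → ℝ) (η : ℝ → Fin (n-1) → ℝ),
          y₀ ∈ U → quadForm (A 0 y₀) η₀ η₀ = 1 → 0 < s → s ≤ c →
          IsShortGeo n ε U A y₀ η₀ s T x y ξ η →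
          ∀ t ∈ Set.Icc (0:ℝ) T,
            1/2 ≤ quadForm (A (x t) (y t)) (η t) (η t) ∧
            quadForm (A (x t) (y t)) (η t) (η t) ≤ 3/2 := by
  have hn1 : (0 : ℝ) < ((n - 1 : ℕ) : ℝ) := by exact_mod_cast (by omega : 0 < n - 1)
  have hLam : 0 < Lam := hlam.trans_le hll
  set C : ℝ := ((n - 1 : ℕ) : ℝ) * Lam / lam
  have hC : 0 < C := by positivity
  refine ⟨1 / (20 * C), by positivity, ?_⟩
  rintro ε U A hA y₀ η₀ s T x y ξ η - hη₀ hs hsc ⟨-, h, hx0, rfl, rfl, rfl, -, -⟩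
  refine reduced_flow_bounds_of_small (P := fun t => quadForm (dxA A (x t) (y t)) (η t) (η t))
    hC h.hx h.hxi (fun t ht => hasDerivAt_quadForm_traj hA h ht) (fun t ht => ?_) hx0
    (by rwa [hx0]) hs (fun t ht => (h.mem t ht).1.1) hsc
  obtain ⟨hxt, hyt⟩ := h.mem t ht
  calc |quadForm (dxA A (x t) (y t)) (η t) (η t)|
      ≤ ((n - 1 : ℕ) : ℝ) * Lam * ∑ i, η t i ^ 2 :=
        abs_quadForm_le hLam.le (hA.hderivBound _ hxt _ hyt).1 _
    _ = C * (lam * ∑ i, η t i ^ 2) := by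
        simp only [C]
        field_simp
    _ ≤ C * quadForm (A (x t) (y t)) (η t) (η t) :=
        mul_le_mul_of_nonneg_left (hA.hposdef _ hxt _ hyt _).1 hC.le
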